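/- For every μ ≥ 0 and λ ∈ [0,1], G^{(μ,λ)}(R,Δ|P) = −λR − μΔ + min over joint distributions p on 𝒳×𝒴 with all components positive of { −log E_p[ P(X) exp(−μ d(X,Y)) / ( p_X(X)^{1−λ} p_{X|Y}(X|Y)^{λ} ) ] }, and consequently G(R,Δ|P) = sup over λ ∈ [0,1] of sup over μ ≥ 0 of { −λR − μΔ + min over such p of ( −log E_p[ P(X) exp(−μ d(X,Y)) / ( p_X(X)^{1−λ} p_{X|Y}(X|Y)^{λ} ) ] ) } for all R ≥ 0 and Δ ≥ 0. -/

import Mathlib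

open Real Filter

noncomputable section

def IsDist {X : Type*} [Fintype X] (P : X → ℝ) : Prop :=
  (∀ x, 0 ≤ P x) ∧ ∑ x, P x = 1

def IsJoint {X Y : Type*} [Fintype X] [Fintype Y] (q : X → Y → ℝ) : Prop :=
  (∀ x y, 0 ≤ q x y) ∧ ∑ x, ∑ y, q x y = 1

def IsCond {X Y : Type*} [Fintype X] [Fintype Y] (V : X → Y → ℝ) : Prop :=
  (∀ x y, 0 ≤ V x y) ∧ ∀ x, ∑ y, V x y = 1

def margX {X Y : Type*} [Fintype Y] (q : X → Y → ℝ) (x : X) : ℝ := ∑ y, q x y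

def margY {X Y : Type*} [Fintype X] (q : X → Y → ℝ) (y : Y) : ℝ := ∑ x, q x y

/-- conditional distribution of `X` given `Y` : `q_{X|Y}(x|y)` -/
def condXY {X Y : Type*} [Fintype X] (q : X → Y → ℝ) (x : X) (y : Y) : ℝ :=
  q x y / margY q y

/-- conditional distribution of `Y` given `X` : `q_{Y|X}(y|x)` -/
def condYX {X Y : Type*} [Fintype Y] (q : X → Y → ℝ) (x : X) (y : Y) : ℝ :=
  q x y / margX q x

/-- mutual information `I(q_X, q_{Y|X})` of a joint distribution `q` -/
def mutInfo {X Y : Type*} [Fintype X] [Fintype Y] (q : X → Y → ℝ) : ℝ :=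
  ∑ x, ∑ y, q x y * Real.log (q x y / (margX q x * margY q y))

/-- divergence `D(q_X ‖ P)` -/
def klX {X Y : Type*} [Fintype X] [Fintype Y] (q : X → Y → ℝ) (P : X → ℝ) : ℝ :=
  ∑ x, margX q x * Real.log (margX q x / P x)

/-- divergence `D(p ‖ q)` of distributions on `X` -/
def klD {X : Type*} [Fintype X] (p q : X → ℝ) : ℝ :=
  ∑ x, p x * Real.log (p x / q x)

/-- divergence `D(q ‖ p)` of joint distributions -/
def klJoint {X Y : Type*} [Fintype X] [Fintype Y] (q p : X → Y → ℝ) : ℝ :=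
  ∑ x, ∑ y, q x y * Real.log (q x y / p x y)

/-- expected distortion `E_q[d(X,Y)]` -/
def Ed {X Y : Type*} [Fintype X] [Fintype Y] (q d : X → Y → ℝ) : ℝ :=
  ∑ x, ∑ y, q x y * d x y

/-- `G(R,Δ|P)` -/
def G {X Y : Type*} [Fintype X] [Fintype Y] (P : X → ℝ) (d : X → Y → ℝ) (R Δ : ℝ) : ℝ :=
  sInf {v : ℝ | ∃ q : X → Y → ℝ, IsJoint q ∧ Ed q d ≤ Δ ∧
    v = max 0 (mutInfo q - R) + klX q P}

/-- `G^{(λ)}(R,Δ|P)` -/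
def Glam {X Y : Type*} [Fintype X] [Fintype Y] (P : X → ℝ) (d : X → Y → ℝ)
    (lam R Δ : ℝ) : ℝ :=
  sInf {v : ℝ | ∃ q : X → Y → ℝ, IsJoint q ∧ Ed q d ≤ Δ ∧
    v = lam * (mutInfo q - R) + klX q P}

/-- rate distortion function `R(Δ|P)` -/
def RD {X Y : Type*} [Fintype X] [Fintype Y] (P : X → ℝ) (d : X → Y → ℝ) (Δ : ℝ) : ℝ :=
  sInf {v : ℝ | ∃ V : X → Y → ℝ, IsCond V ∧ Ed (fun x y => P x * V x y) d ≤ Δ ∧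
    v = mutInfo (fun x y => P x * V x y)}

/-- `Ω^{(μ,λ)}(P)` -/
def OmegaF {X Y : Type*} [Fintype X] [Fintype Y] (P : X → ℝ) (d : X → Y → ℝ)
    (μ lam : ℝ) : ℝ :=
  sInf {v : ℝ | ∃ q : X → Y → ℝ, IsJoint q ∧
    v = lam * mutInfo q + klX q P + μ * Ed q d}

/-- `G^{(μ,λ)}(R,Δ|P) = Ω^{(μ,λ)}(P) − λR − μΔ` -/
def Gmulam {X Y : Type*} [Fintype X] [Fintype Y] (P : X → ℝ) (d : X → Y → ℝ)
    (μ lam R Δ : ℝ) : ℝ :=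
  OmegaF P d μ lam - lam * R - μ * Δ

/-- `ω_q^{(μ,λ)}(x,y)` -/
def omg {X Y : Type*} [Fintype X] [Fintype Y] (P : X → ℝ) (d : X → Y → ℝ)
    (μ lam : ℝ) (q : X → Y → ℝ) (x : X) (y : Y) : ℝ :=
  Real.log (margX q x ^ (1 - lam) * condXY q x y ^ lam * Real.exp (μ * d x y) / P x)

/-- `F^{(μ,λ)}(p,q) = E_q[ω_p^{(μ,λ)}(X,Y)] + D(q‖p)` -/
def Ffun {X Y : Type*} [Fintype X] [Fintype Y] (P : X → ℝ) (d : X → Y → ℝ)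
    (μ lam : ℝ) (p q : X → Y → ℝ) : ℝ :=
  (∑ x, ∑ y, q x y * omg P d μ lam p x y) + klJoint q p

/-- `Λ_p^{(μ,λ)} = E_p[exp(−ω_p^{(μ,λ)}(X,Y))]` -/
def Lam {X Y : Type*} [Fintype X] [Fintype Y] (P : X → ℝ) (d : X → Y → ℝ)
    (μ lam : ℝ) (p : X → Y → ℝ) : ℝ :=
  ∑ x, ∑ y, p x y * Real.exp (-(omg P d μ lam p x y))

/-- cutoff rate `R_cut^{(λ)}(Δ|P)` -/
def Rcut {X Y : Type*} [Fintype X] [Fintype Y] (P : X → ℝ) (d : X → Y → ℝ)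
    (lam Δ : ℝ) : ℝ :=
  sInf {v : ℝ | ∃ q : X → Y → ℝ, IsJoint q ∧ Ed q d ≤ Δ ∧
    v = mutInfo q + (1 / lam) * klX q P}

/-- Shannon entropy -/
def entropy {X : Type*} [Fintype X] (p : X → ℝ) : ℝ :=
  -∑ x, p x * Real.log (p x)

/-- the inner minimum `min_p { −log E_p[ P(X)exp(−μd(X,Y)) / (p_X(X)^{1−λ} p_{X|Y}(X|Y)^λ) ] }`
over joint distributions `p` with all components positive -/
def innerMin {X Y : Type*} [Fintype X] [Fintype Y] (P : X → ℝ) (d : X → Y → ℝ)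
    (μ lam : ℝ) : ℝ :=
  sInf {v : ℝ | ∃ p : X → Y → ℝ, IsJoint p ∧ (∀ x y, 0 < p x y) ∧
    v = -Real.log (∑ x, ∑ y, p x y *
      (P x * Real.exp (-(μ * d x y)) /
        (margX p x ^ (1 - lam) * condXY p x y ^ lam)))}

theorem logSum_le {ι : Type*} [Fintype ι] (u v : ι → ℝ) (hu : ∀ i, 0 ≤ u i) (hv : ∀ i, 0 ≤ v i)
    (huv : ∀ i, v i = 0 → u i = 0) :
    (∑ i, u i) * log (∑ i, u i) - (∑ i, u i) * log (∑ i, v i) ≤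
      ∑ i, u i * log (u i) - ∑ i, u i * log (v i) := by
  rcases (Finset.sum_nonneg fun i _ => hu i : 0 ≤ ∑ i, u i).eq_or_lt with h0 | hU
  · have : ∀ i, u i = 0 := fun i =>
      (Finset.sum_eq_zero_iff_of_nonneg fun i _ => hu i).1 h0.symm i (Finset.mem_univ i)
    simp [this]
  · have hV : 0 < ∑ i, v i := by
      refine (Finset.sum_nonneg fun i _ => hv i).lt_of_ne fun h => hU.ne' ?_
      exact Finset.sum_eq_zero fun i _ => huv i
        ((Finset.sum_eq_zero_iff_of_nonneg fun i _ => hv i).1 h.symm i (Finset.mem_univ i))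
    set U := ∑ i, u i with hUdef
    set V := ∑ i, v i with hVdef
    have key : ∀ i, u i * (log U - log V) + (u i - v i * (U / V)) ≤
        u i * log (u i) - u i * log (v i) := by
      intro i
      rcases (hu i).eq_or_lt with h | h
      · have : 0 ≤ v i * (U / V) := mul_nonneg (hv i) (by positivity)
        rw [← h]; simpa using this
      · have hvi : 0 < v i := (hv i).lt_of_ne fun e => h.ne' (huv i e.symm)
        have h1 := log_le_sub_one_of_pos (show 0 < v i * (U / V) / u i by positivity)
        rw [log_div (by positivity) h.ne', log_mul hvi.ne' (by positivity),
          log_div hU.ne' hV.ne'] at h1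
        have h2 := mul_le_mul_of_nonneg_left h1 h.le
        have h3 : u i * (v i * (U / V) / u i - 1) = v i * (U / V) - u i := by
          field_simp
        rw [h3] at h2
        linarith
    have hsum := Finset.sum_le_sum fun i (_ : i ∈ Finset.univ) => key i
    rw [Finset.sum_add_distrib, Finset.sum_sub_distrib, Finset.sum_sub_distrib, ← Finset.sum_mul,
      ← Finset.sum_mul, ← hUdef, ← hVdef, mul_div_cancel₀ _ hV.ne'] at hsum
    linarith

theorem sum_mul_log_sub_convex {ι : Type*} [Fintype ι] {a b : ℝ} (ha : 0 ≤ a) (hb : 0 ≤ b)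
    (u v : ι → ℝ) (hu : ∀ i, 0 ≤ u i) (hv : ∀ i, 0 ≤ v i) (hab : a + b = 1) :
    ∑ i, (a * u i + b * v i) * log (a * u i + b * v i) -
        (a * ∑ i, u i + b * ∑ i, v i) * log (a * ∑ i, u i + b * ∑ i, v i) ≤
      a * (∑ i, u i * log (u i) - (∑ i, u i) * log (∑ i, u i)) +
        b * (∑ i, v i * log (v i) - (∑ i, v i) * log (∑ i, v i)) := by
  rcases ha.eq_or_lt with rfl | ha'
  · obtain rfl : b = 1 := by linarith
    simp
  rcases hb.eq_or_lt with rfl | hb'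
  · obtain rfl : a = 1 := by linarith
    simp
  have hw : ∀ i, 0 ≤ a * u i + b * v i := fun i => by
    have := hu i; have := hv i; positivity
  have h1 := logSum_le u (fun i => a * u i + b * v i) hu hw fun i h => by
    have := hu i; have := mul_nonneg hb (hv i)
    nlinarith
  have h2 := logSum_le v (fun i => a * u i + b * v i) hv hw fun i h => by
    have := hv i; have := mul_nonneg ha (hu i)
    nlinarith
  have hW : ∑ i, (a * u i + b * v i) = a * ∑ i, u i + b * ∑ i, v i := by
    rw [Finset.sum_add_distrib, Finset.mul_sum, Finset.mul_sum]
  have hL : ∑ i, (a * u i + b * v i) * log (a * u i + b * v i) =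
      a * ∑ i, u i * log (a * u i + b * v i) + b * ∑ i, v i * log (a * u i + b * v i) := by
    rw [Finset.mul_sum, Finset.mul_sum, ← Finset.sum_add_distrib]
    exact Finset.sum_congr rfl fun i _ => by ring
  rw [hW] at h1 h2
  rw [hL]
  have := mul_le_mul_of_nonneg_left h1 ha
  have := mul_le_mul_of_nonneg_left h2 hb
  linarith

section joint

variable {X Y : Type*}

theorem margX_nonneg [Fintype Y] {q : X → Y → ℝ} (hq : ∀ x y, 0 ≤ q x y) (x : X) : 0 ≤ margX q x :=
  Finset.sum_nonneg fun y _ => hq x y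

theorem margY_nonneg [Fintype X] {q : X → Y → ℝ} (hq : ∀ x y, 0 ≤ q x y) (y : Y) : 0 ≤ margY q y :=
  Finset.sum_nonneg fun x _ => hq x y

theorem le_margX [Fintype Y] {q : X → Y → ℝ} (hq : ∀ x y, 0 ≤ q x y) (x : X) (y : Y) :
    q x y ≤ margX q x :=
  Finset.single_le_sum (f := fun y => q x y) (fun y _ => hq x y) (Finset.mem_univ y)

theorem le_margY [Fintype X] {q : X → Y → ℝ} (hq : ∀ x y, 0 ≤ q x y) (x : X) (y : Y) :
    q x y ≤ margY q y :=
  Finset.single_le_sum (f := fun x => q x y) (fun x _ => hq x y) (Finset.mem_univ x)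

theorem margX_pos [Fintype Y] [Nonempty Y] {p : X → Y → ℝ} (hp : ∀ x y, 0 < p x y) (x : X) :
    0 < margX p x :=
  Finset.sum_pos (fun y _ => hp x y) Finset.univ_nonempty

theorem margY_pos [Fintype X] [Nonempty X] {p : X → Y → ℝ} (hp : ∀ x y, 0 < p x y) (y : Y) :
    0 < margY p y :=
  Finset.sum_pos (fun x _ => hp x y) Finset.univ_nonempty

theorem margX_convexComb [Fintype Y] (q r : X → Y → ℝ) (a b : ℝ) (x : X) :
    margX (a • q + b • r) x = a * margX q x + b * margX r x := by
  simp [margX, Finset.sum_add_distrib, Finset.mul_sum]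

theorem margY_convexComb [Fintype X] (q r : X → Y → ℝ) (a b : ℝ) (y : Y) :
    margY (a • q + b • r) y = a * margY q y + b * margY r y := by
  simp [margY, Finset.sum_add_distrib, Finset.mul_sum]

variable [Fintype X] [Fintype Y]

theorem IsJoint.sum_margX {q : X → Y → ℝ} (hq : IsJoint q) : ∑ x, margX q x = 1 := hq.2

theorem IsJoint.sum_margY {q : X → Y → ℝ} (hq : IsJoint q) : ∑ y, margY q y = 1 := by
  rw [← hq.2, Finset.sum_comm]; rfl

theorem sum_mul_left_eq_margX (q : X → Y → ℝ) (f : X → ℝ) :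
    ∑ x, ∑ y, q x y * f x = ∑ x, margX q x * f x := by
  simp only [margX, Finset.sum_mul]

theorem sum_mul_right_eq_margY (q : X → Y → ℝ) (f : Y → ℝ) :
    ∑ x, ∑ y, q x y * f y = ∑ y, margY q y * f y := by
  rw [Finset.sum_comm]
  simp only [margY, Finset.sum_mul]

theorem mutInfo_eq {q : X → Y → ℝ} (hq : ∀ x y, 0 ≤ q x y) :
    mutInfo q = ∑ x, ∑ y, q x y * log (q x y) - ∑ x, margX q x * log (margX q x) -
      ∑ y, margY q y * log (margY q y) := by
  rw [← sum_mul_left_eq_margX, ← sum_mul_right_eq_margY]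
  simp only [mutInfo, ← Finset.sum_sub_distrib]
  refine Finset.sum_congr rfl fun x _ => Finset.sum_congr rfl fun y _ => ?_
  rcases (hq x y).eq_or_lt with h | h
  · simp [← h]
  · have hx := h.trans_le (le_margX hq x y)
    have hy := h.trans_le (le_margY hq x y)
    rw [log_div h.ne' (by positivity), log_mul hx.ne' hy.ne']
    ring

theorem klX_eq {P : X → ℝ} (hP : ∀ x, 0 < P x) (q : X → Y → ℝ) :
    klX q P = ∑ x, margX q x * log (margX q x) - ∑ x, margX q x * log (P x) := by
  simp only [klX, ← Finset.sum_sub_distrib]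
  refine Finset.sum_congr rfl fun x _ => ?_
  rcases eq_or_ne (margX q x) 0 with h | h
  · simp [h]
  · rw [log_div h (hP x).ne']; ring

theorem continuous_klX {P : X → ℝ} (hP : ∀ x, 0 < P x) :
    Continuous fun q : X → Y → ℝ => klX q P := by
  simp only [klX_eq hP, margX]
  have h : ∀ x, Continuous fun q : X → Y → ℝ => (∑ y, q x y) * log (∑ y, q x y) := fun x =>
    Real.continuous_mul_log.comp (by fun_prop : Continuous fun q : X → Y → ℝ => ∑ y, q x y)
  exact (continuous_finsetSum _ fun x _ => h x).sub (by fun_prop)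

theorem continuousOn_mutInfo :
    ContinuousOn (fun q : X → Y → ℝ => mutInfo q) {q | IsJoint q} := by
  refine ContinuousOn.congr (Continuous.continuousOn ?_) fun q hq => mutInfo_eq hq.1
  simp only [margX, margY]
  refine ((continuous_finsetSum _ fun x _ => continuous_finsetSum _ fun y _ => ?_).sub
    (continuous_finsetSum _ fun x _ => ?_)).sub (continuous_finsetSum _ fun y _ => ?_)
  · exact Real.continuous_mul_log.comp (by fun_prop : Continuous fun q : X → Y → ℝ => q x y)
  · exact Real.continuous_mul_log.comp (by fun_prop : Continuous fun q : X → Y → ℝ => ∑ y, q x y)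
  · exact Real.continuous_mul_log.comp (by fun_prop : Continuous fun q : X → Y → ℝ => ∑ x, q x y)

theorem continuous_Ed (d : X → Y → ℝ) : Continuous fun q : X → Y → ℝ => Ed q d := by
  unfold Ed; fun_prop

theorem isCompact_isJoint : IsCompact {q : X → Y → ℝ | IsJoint q} := by
  refine (isCompact_Icc : IsCompact (Set.Icc (0 : X → Y → ℝ) 1)).of_isClosed_subset ?_ ?_
  · have h : {q : X → Y → ℝ | IsJoint q} =
        Set.Ici 0 ∩ {q | ∑ x, ∑ y, q x y = 1} := by
      ext q; simp [IsJoint, Pi.le_def]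
    rw [h]
    exact isClosed_Ici.inter (isClosed_eq (by fun_prop) continuous_const)
  · intro q hq
    refine ⟨fun x y => hq.1 x y, fun x y => (le_margX hq.1 x y).trans ?_⟩
    have := Finset.single_le_sum (f := margX q) (fun x _ => margX_nonneg hq.1 x)
      (Finset.mem_univ x)
    rw [hq.sum_margX] at this
    exact this

theorem IsJoint.convexComb {q r : X → Y → ℝ} (hq : IsJoint q) (hr : IsJoint r) {a b : ℝ}
    (ha : 0 ≤ a) (hb : 0 ≤ b) (hab : a + b = 1) : IsJoint (a • q + b • r) := by
  refine ⟨fun x y => ?_, ?_⟩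
  · have := hq.1 x y; have := hr.1 x y
    simp only [Pi.add_apply, Pi.smul_apply, smul_eq_mul]; positivity
  · simp only [Pi.add_apply, Pi.smul_apply, smul_eq_mul, Finset.sum_add_distrib,
      ← Finset.mul_sum, hq.2, hr.2]
    linarith

theorem Ed_convexComb (d q r : X → Y → ℝ) (a b : ℝ) :
    Ed (a • q + b • r) d = a * Ed q d + b * Ed r d := by
  simp only [Ed, Pi.add_apply, Pi.smul_apply, smul_eq_mul, add_mul, Finset.sum_add_distrib,
    Finset.mul_sum, mul_assoc]

theorem klX_convexComb_le {P : X → ℝ} (hP : ∀ x, 0 < P x) {q r : X → Y → ℝ} (hq : IsJoint q)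
    (hr : IsJoint r) {a b : ℝ} (ha : 0 ≤ a) (hb : 0 ≤ b) (hab : a + b = 1) :
    klX (a • q + b • r) P ≤ a * klX q P + b * klX r P := by
  simp only [klX_eq hP, margX_convexComb, ← Finset.sum_sub_distrib, Finset.mul_sum,
    ← Finset.sum_add_distrib]
  refine Finset.sum_le_sum fun x _ => ?_
  have := Real.convexOn_mul_log.2 (margX_nonneg hq.1 x) (margX_nonneg hr.1 x) ha hb hab
  simp only [smul_eq_mul] at this
  linarith

theorem mutInfo_add_klX_convexComb_le {P : X → ℝ} (hP : ∀ x, 0 < P x) {q r : X → Y → ℝ}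
    (hq : IsJoint q) (hr : IsJoint r) {a b : ℝ} (ha : 0 ≤ a) (hb : 0 ≤ b) (hab : a + b = 1) :
    mutInfo (a • q + b • r) + klX (a • q + b • r) P ≤
      a * (mutInfo q + klX q P) + b * (mutInfo r + klX r P) := by
  have key : ∀ s : X → Y → ℝ, IsJoint s → mutInfo s + klX s P =
      ∑ y, (∑ x, s x y * log (s x y) - margY s y * log (margY s y)) -
        ∑ x, margX s x * log (P x) := fun s hs => by
    rw [mutInfo_eq hs.1, klX_eq hP, Finset.sum_sub_distrib,
      Finset.sum_comm (f := fun y x => s x y * log (s x y))]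
    ring
  have hlin : ∑ x, margX (a • q + b • r) x * log (P x) =
      a * ∑ x, margX q x * log (P x) + b * ∑ x, margX r x * log (P x) := by
    simp only [margX_convexComb, Finset.mul_sum, ← Finset.sum_add_distrib]
    exact Finset.sum_congr rfl fun x _ => by ring
  have hconv : ∑ y, (∑ x, (a • q + b • r) x y * log ((a • q + b • r) x y) -
      margY (a • q + b • r) y * log (margY (a • q + b • r) y)) ≤
      a * ∑ y, (∑ x, q x y * log (q x y) - margY q y * log (margY q y)) +
      b * ∑ y, (∑ x, r x y * log (r x y) - margY r y * log (margY r y)) := by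
    simp only [margY_convexComb]
    rw [Finset.mul_sum, Finset.mul_sum, ← Finset.sum_add_distrib]
    exact Finset.sum_le_sum fun y _ => sum_mul_log_sub_convex ha hb (fun x => q x y)
      (fun x => r x y) (fun x => hq.1 x y) (fun x => hr.1 x y) hab
  rw [key _ (hq.convexComb hr ha hb hab), key _ hq, key _ hr, hlin]
  linarith
/-- The Lagrangian `λ I(q) + D(q_X ‖ P) + μ E_q[d]` minimised in `OmegaF`. -/
def lagrangian (P : X → ℝ) (d : X → Y → ℝ) (μ lam : ℝ) (q : X → Y → ℝ) : ℝ :=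
  lam * mutInfo q + klX q P + μ * Ed q d

/-- The weight `P(x) exp(−μ d(x,y)) / (p_X(x)^{1−λ} p_{X|Y}(x|y)^λ)` averaged in `innerMin`. -/
def tiltWeight (P : X → ℝ) (d : X → Y → ℝ) (μ lam : ℝ) (p : X → Y → ℝ) (x : X) (y : Y) : ℝ :=
  P x * Real.exp (-(μ * d x y)) / (margX p x ^ (1 - lam) * condXY p x y ^ lam)

theorem continuousOn_lagrangian {P : X → ℝ} (hP : ∀ x, 0 < P x) (d : X → Y → ℝ) (μ lam : ℝ) :
    ContinuousOn (lagrangian P d μ lam) {q | IsJoint q} :=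
  ((continuousOn_const.mul continuousOn_mutInfo).add (continuous_klX hP).continuousOn).add
    (continuousOn_const.mul (continuous_Ed d).continuousOn)

theorem bddBelow_lagrangian {P : X → ℝ} (hP : ∀ x, 0 < P x) (d : X → Y → ℝ) (μ lam : ℝ) :
    BddBelow {v : ℝ | ∃ q : X → Y → ℝ, IsJoint q ∧
      v = lam * mutInfo q + klX q P + μ * Ed q d} := by
  refine (isCompact_isJoint.bddBelow_image (continuousOn_lagrangian hP d μ lam)).mono ?_
  rintro _ ⟨q, hq, rfl⟩
  exact ⟨q, hq, rfl⟩

section positive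

variable {P : X → ℝ} {p : X → Y → ℝ}

variable [Nonempty X] [Nonempty Y]

theorem tiltWeight_pos (hP : ∀ x, 0 < P x) (d : X → Y → ℝ) (μ lam : ℝ)
    (hp : ∀ x y, 0 < p x y) (x : X) (y : Y) : 0 < tiltWeight P d μ lam p x y := by
  have hX := margX_pos hp x
  have hY := margY_pos hp y
  have hxy := hp x y
  have hPx := hP x
  unfold tiltWeight condXY
  positivity

theorem sum_mul_log_tiltWeight (hP : ∀ x, 0 < P x) (d : X → Y → ℝ) (μ lam : ℝ)
    (hp : ∀ x y, 0 < p x y) (q : X → Y → ℝ) :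
    ∑ x, ∑ y, q x y * log (tiltWeight P d μ lam p x y) =
      ∑ x, margX q x * log (P x) - μ * Ed q d -
        (1 - lam) * ∑ x, margX q x * log (margX p x) -
        lam * (∑ x, ∑ y, q x y * log (p x y) - ∑ y, margY q y * log (margY p y)) := by
  have hlog : ∀ x y, log (tiltWeight P d μ lam p x y) =
      log (P x) - μ * d x y - (1 - lam) * log (margX p x) -
        lam * (log (p x y) - log (margY p y)) := by
    intro x y
    have hX := margX_pos hp x
    have hY := margY_pos hp y
    have hxy := hp x y
    have hPx := hP x
    have hc : 0 < condXY p x y := div_pos hxy hY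
    rw [tiltWeight, log_div (by positivity) (by positivity), log_mul hPx.ne' (by positivity),
      log_exp, log_mul (by positivity) (by positivity), log_rpow hX, log_rpow hc, condXY,
      log_div hxy.ne' hY.ne']
    ring
  simp only [← sum_mul_left_eq_margX, ← sum_mul_right_eq_margY, Ed, Finset.mul_sum,
    ← Finset.sum_sub_distrib, hlog]
  exact Finset.sum_congr rfl fun x _ => Finset.sum_congr rfl fun y _ => by ring

theorem sum_mul_tiltWeight_pos (hP : ∀ x, 0 < P x) (d : X → Y → ℝ) (μ lam : ℝ)
    (hp : ∀ x y, 0 < p x y) : 0 < ∑ x, ∑ y, p x y * tiltWeight P d μ lam p x y :=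
  Finset.sum_pos (fun x _ => Finset.sum_pos
    (fun y _ => mul_pos (hp x y) (tiltWeight_pos hP d μ lam hp x y)) Finset.univ_nonempty)
    Finset.univ_nonempty

/-- Jensen's inequality for the logarithm of the averaged weight. -/
theorem neg_log_sum_tiltWeight_le (hP : ∀ x, 0 < P x) (d : X → Y → ℝ) (μ lam : ℝ)
    (hpj : IsJoint p) (hp : ∀ x y, 0 < p x y) :
    -log (∑ x, ∑ y, p x y * tiltWeight P d μ lam p x y) ≤ lagrangian P d μ lam p := by
  have h := logSum_le (fun z : X × Y => p z.1 z.2)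
    (fun z => p z.1 z.2 * tiltWeight P d μ lam p z.1 z.2) (fun z => hpj.1 _ _)
    (fun z => (mul_pos (hp _ _) (tiltWeight_pos hP d μ lam hp _ _)).le)
    (fun z hz => absurd hz (mul_pos (hp _ _) (tiltWeight_pos hP d μ lam hp _ _)).ne')
  simp only [Fintype.sum_prod_type, hpj.2, log_one, mul_zero, one_mul, zero_sub] at h
  have hlog : ∑ x, ∑ y, p x y * log (p x y * tiltWeight P d μ lam p x y) =
      ∑ x, ∑ y, p x y * log (p x y) + ∑ x, ∑ y, p x y * log (tiltWeight P d μ lam p x y) := by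
    simp only [← Finset.sum_add_distrib]
    refine Finset.sum_congr rfl fun x _ => Finset.sum_congr rfl fun y _ => ?_
    rw [log_mul (hp x y).ne' (tiltWeight_pos hP d μ lam hp x y).ne']
    ring
  rw [hlog, sum_mul_log_tiltWeight hP d μ lam hp] at h
  rw [lagrangian, mutInfo_eq hpj.1, klX_eq hP]
  linarith

/-- The tilted distribution `q ∝ p · tiltWeight` has Lagrangian at most `−log E_p[tiltWeight]`. -/
theorem exists_lagrangian_le (hP : ∀ x, 0 < P x) (d : X → Y → ℝ) {μ lam : ℝ}
    (h0 : 0 ≤ lam) (h1 : lam ≤ 1) (hpj : IsJoint p) (hp : ∀ x y, 0 < p x y) :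
    ∃ q : X → Y → ℝ, IsJoint q ∧ lagrangian P d μ lam q ≤
      -log (∑ x, ∑ y, p x y * tiltWeight P d μ lam p x y) := by
  have hL := sum_mul_tiltWeight_pos hP d μ lam hp
  set L := ∑ x, ∑ y, p x y * tiltWeight P d μ lam p x y with hLdef
  have hw := tiltWeight_pos hP d μ lam hp
  let q : X → Y → ℝ := fun x y => p x y * tiltWeight P d μ lam p x y / L
  have hqpos : ∀ x y, 0 < q x y := fun x y => div_pos (mul_pos (hp x y) (hw x y)) hL
  have hq : IsJoint q := by
    refine ⟨fun x y => (hqpos x y).le, ?_⟩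
    simp only [q, ← Finset.sum_div]
    exact div_self hL.ne'
  refine ⟨q, hq, ?_⟩
  have hlog : ∑ x, ∑ y, q x y * log (q x y) = ∑ x, ∑ y, q x y * log (p x y) +
      ∑ x, ∑ y, q x y * log (tiltWeight P d μ lam p x y) - log L := by
    have hone : log L = ∑ x, ∑ y, q x y * log L := by
      simp only [← Finset.sum_mul, hq.2, one_mul]
    rw [hone]
    simp only [← Finset.sum_add_distrib, ← Finset.sum_sub_distrib]
    refine Finset.sum_congr rfl fun x _ => Finset.sum_congr rfl fun y _ => ?_
    have : log (q x y) = log (p x y) + log (tiltWeight P d μ lam p x y) - log L := by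
      rw [← log_mul (hp x y).ne' (hw x y).ne', ← log_div (mul_pos (hp x y) (hw x y)).ne' hL.ne']
    rw [this]; ring
  have hX : ∑ x, margX q x * log (margX q x) - ∑ x, margX q x * log (margX p x) ≤
      ∑ x, ∑ y, q x y * log (q x y) - ∑ x, ∑ y, q x y * log (p x y) := by
    simp only [← Finset.sum_sub_distrib (f := fun x => margX q x * log (margX q x)),
      ← Finset.sum_sub_distrib (f := fun x => ∑ y, q x y * log (q x y))]
    exact Finset.sum_le_sum fun x _ => logSum_le (q x) (p x) (fun y => (hqpos x y).le)
      (fun y => (hp x y).le) (fun y h => absurd h (hp x y).ne')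
  have hY : 0 ≤ ∑ y, margY q y * log (margY q y) - ∑ y, margY q y * log (margY p y) := by
    have := logSum_le (margY q) (margY p) (margY_nonneg hq.1) (margY_nonneg hpj.1)
      (fun y h => absurd h (margY_pos hp y).ne')
    simpa [hq.sum_margY, hpj.sum_margY] using this
  have hX' := mul_le_mul_of_nonneg_left hX (sub_nonneg.2 h1)
  have hY' := mul_nonneg h0 hY
  rw [sum_mul_log_tiltWeight hP d μ lam hp] at hlog
  rw [lagrangian, mutInfo_eq hq.1, klX_eq hP]
  linarith

end positive

theorem isJoint_uniform [Nonempty X] [Nonempty Y] :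
    IsJoint fun (_ : X) (_ : Y) => ((Fintype.card X : ℝ) * Fintype.card Y)⁻¹ := by
  refine ⟨fun _ _ => by positivity, ?_⟩
  have hX : (Fintype.card X : ℝ) ≠ 0 := by simp
  have hY : (Fintype.card Y : ℝ) ≠ 0 := by simp
  simp only [Finset.sum_const, Finset.card_univ, nsmul_eq_mul]
  field_simp

theorem omegaF_eq_innerMin [Nonempty X] [Nonempty Y] {P : X → ℝ} (hP : ∀ x, 0 < P x)
    (d : X → Y → ℝ) {μ lam : ℝ} (h0 : 0 ≤ lam) (h1 : lam ≤ 1) :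
    OmegaF P d μ lam = innerMin P d μ lam := by
  let u : X → Y → ℝ := fun _ _ => ((Fintype.card X : ℝ) * Fintype.card Y)⁻¹
  have hu : IsJoint u := isJoint_uniform
  have hupos : ∀ x y, 0 < u x y := fun _ _ => by positivity
  have hlow : ∀ v ∈ {v : ℝ | ∃ p : X → Y → ℝ, IsJoint p ∧ (∀ x y, 0 < p x y) ∧
      v = -log (∑ x, ∑ y, p x y * tiltWeight P d μ lam p x y)}, OmegaF P d μ lam ≤ v := by
    rintro _ ⟨p, hpj, hp, rfl⟩
    obtain ⟨q, hq, hle⟩ := exists_lagrangian_le (μ := μ) hP d h0 h1 hpj hp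
    exact (csInf_le (bddBelow_lagrangian hP d μ lam) ⟨q, hq, rfl⟩).trans hle
  apply le_antisymm
  · exact le_csInf ⟨_, u, hu, hupos, rfl⟩ hlow
  · refine le_csInf ⟨_, u, hu, rfl⟩ ?_
    rintro _ ⟨q, hq, rfl⟩
    let r : ℝ → X → Y → ℝ := fun t => (1 - t) • q + t • u
    have hr : ∀ t ∈ Set.Ioo (0 : ℝ) 1, IsJoint (r t) := fun t ht =>
      hq.convexComb hu (by linarith [ht.2]) ht.1.le (by ring)
    have hrpos : ∀ t ∈ Set.Ioo (0 : ℝ) 1, ∀ x y, 0 < r t x y := fun t ht x y => by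
      have := mul_nonneg (sub_nonneg.2 ht.2.le) (hq.1 x y)
      have := mul_pos ht.1 (hupos x y)
      simp only [r, Pi.add_apply, Pi.smul_apply, smul_eq_mul]
      linarith
    have hle : ∀ t ∈ Set.Ioo (0 : ℝ) 1, innerMin P d μ lam ≤ lagrangian P d μ lam (r t) :=
      fun t ht => (csInf_le ⟨_, hlow⟩ ⟨r t, hr t ht, hrpos t ht, rfl⟩).trans
        (neg_log_sum_tiltWeight_le hP d μ lam (hr t ht) (hrpos t ht))
    have hev : ∀ᶠ t in nhdsWithin (0 : ℝ) (Set.Ioi 0), t ∈ Set.Ioo (0 : ℝ) 1 :=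
      Ioo_mem_nhdsGT one_pos
    have hlim : Tendsto r (nhdsWithin 0 (Set.Ioi 0)) (nhdsWithin q {q | IsJoint q}) := by
      refine tendsto_nhdsWithin_iff.2 ⟨?_, hev.mono hr⟩
      have hc : Continuous r := by fun_prop
      have := (hc.tendsto 0).mono_left (nhdsWithin_le_nhds (s := Set.Ioi 0))
      simpa [r] using this
    exact ge_of_tendsto ((continuousOn_lagrangian hP d μ lam q hq).tendsto.comp hlim)
      (hev.mono hle)

theorem exists_isJoint_Ed_eq_zero {P : X → ℝ} (hP : IsDist P) {d : X → Y → ℝ}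
    (hd0 : ∀ x, ∃ y, d x y = 0) : ∃ q : X → Y → ℝ, IsJoint q ∧ Ed q d = 0 := by
  classical
  choose g hg using hd0
  refine ⟨fun x y => if y = g x then P x else 0, ⟨fun x y => ?_, ?_⟩, ?_⟩
  · have := hP.1 x
    dsimp only
    split_ifs <;> simp [this]
  · simp [hP.2]
  · simp [Ed, hg]

theorem bddBelow_G_set {P : X → ℝ} (hP : ∀ x, 0 < P x) (d : X → Y → ℝ) (R Δ : ℝ) :
    BddBelow {v : ℝ | ∃ q : X → Y → ℝ, IsJoint q ∧ Ed q d ≤ Δ ∧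
      v = max 0 (mutInfo q - R) + klX q P} := by
  obtain ⟨b, hb⟩ := isCompact_isJoint.bddBelow_image
    (continuous_klX (Y := Y) hP).continuousOn
  refine ⟨b, ?_⟩
  rintro _ ⟨q, hq, -, rfl⟩
  have : b ≤ klX q P := hb ⟨q, hq, rfl⟩
  linarith [le_max_left 0 (mutInfo q - R)]

/-- Weak duality. -/
theorem omegaF_sub_le_G {P : X → ℝ} (hP : IsDist P) (hPpos : ∀ x, 0 < P x) {d : X → Y → ℝ}
    (hd0 : ∀ x, ∃ y, d x y = 0) {R Δ μ lam : ℝ} (hΔ : 0 ≤ Δ) (h0 : 0 ≤ lam) (h1 : lam ≤ 1)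
    (hμ : 0 ≤ μ) : -(lam * R) - μ * Δ + OmegaF P d μ lam ≤ G P d R Δ := by
  obtain ⟨q₀, hq₀, hE⟩ := exists_isJoint_Ed_eq_zero hP hd0
  refine le_csInf ⟨_, q₀, hq₀, hE.trans_le hΔ, rfl⟩ ?_
  rintro _ ⟨q, hq, hqE, rfl⟩
  have hΩ : OmegaF P d μ lam ≤ lam * mutInfo q + klX q P + μ * Ed q d :=
    csInf_le (bddBelow_lagrangian hPpos d μ lam) ⟨q, hq, rfl⟩
  have hmax : lam * (mutInfo q - R) ≤ max 0 (mutInfo q - R) :=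
    (mul_le_mul_of_nonneg_left (le_max_right _ _) h0).trans
      (mul_le_of_le_one_left (le_max_left _ _) h1)
  have := mul_le_mul_of_nonneg_left hqE hμ
  linarith

/-- Strong duality, by separating `(t, t, 0)` from the achievable region. -/
theorem exists_le_omegaF_sub {P : X → ℝ} (hP : IsDist P) (hPpos : ∀ x, 0 < P x) {d : X → Y → ℝ}
    (hd0 : ∀ x, ∃ y, d x y = 0) {R Δ t : ℝ} (hΔ : 0 ≤ Δ) (ht : t < G P d R Δ) :
    ∃ lam μ : ℝ, 0 ≤ lam ∧ lam ≤ 1 ∧ 0 ≤ μ ∧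
      t ≤ -(lam * R) - μ * Δ + OmegaF P d μ lam := by
  let F : (X → Y → ℝ) → ℝ × ℝ × ℝ := fun q =>
    (klX q P, mutInfo q + klX q P - R, Ed q d - Δ)
  let C : Set (ℝ × ℝ × ℝ) := {z | ∃ q, IsJoint q ∧ F q ≤ z}
  have hF : ContinuousOn F {q | IsJoint q} :=
    (continuous_klX hPpos).continuousOn.prodMk
      (((continuousOn_mutInfo.add (continuous_klX hPpos).continuousOn).sub
        continuousOn_const).prodMk ((continuous_Ed d).continuousOn.sub continuousOn_const))
  have hclosed : IsClosed C := by
    have := (isClosed_Ici (a := (0 : ℝ × ℝ × ℝ))).add_left_of_isCompact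
      (isCompact_isJoint.image_of_continuousOn hF)
    convert this using 1
    ext z
    constructor
    · rintro ⟨q, hq, hz⟩
      exact ⟨F q, ⟨q, hq, rfl⟩, z - F q, sub_nonneg.2 hz, add_sub_cancel _ _⟩
    · rintro ⟨_, ⟨q, hq, rfl⟩, w, hw, rfl⟩
      exact ⟨q, hq, le_add_of_nonneg_right hw⟩
  have hconv : Convex ℝ C := by
    rintro z ⟨q, hq, hz⟩ w ⟨r, hr, hw⟩ a b ha hb hab
    refine ⟨a • q + b • r, hq.convexComb hr ha hb hab, le_trans ?_
      (add_le_add (smul_le_smul_of_nonneg_left hz ha) (smul_le_smul_of_nonneg_left hw hb))⟩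
    have hR : R = a * R + b * R := by rw [← add_mul, hab, one_mul]
    have hΔ' : Δ = a * Δ + b * Δ := by rw [← add_mul, hab, one_mul]
    refine ⟨klX_convexComb_le hPpos hq hr ha hb hab, ?_, ?_⟩
    · have := mutInfo_add_klX_convexComb_le hPpos hq hr ha hb hab
      simp only [F, Prod.smul_mk, Prod.mk_add_mk, smul_eq_mul]
      linarith
    · simp only [F, Prod.smul_mk, Prod.mk_add_mk, smul_eq_mul, Ed_convexComb]
      linarith
  have hnot : ((t, t, 0) : ℝ × ℝ × ℝ) ∉ C := by
    rintro ⟨q, hq, hk, hi, he⟩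
    simp only [F] at hk hi he
    have hG : G P d R Δ ≤ max 0 (mutInfo q - R) + klX q P :=
      csInf_le (bddBelow_G_set hPpos d R Δ) ⟨q, hq, by linarith, rfl⟩
    rcases max_cases 0 (mutInfo q - R) with ⟨h, -⟩ | ⟨h, -⟩ <;> rw [h] at hG <;> linarith
  obtain ⟨f, u, hfu, hCu⟩ := geometric_hahn_banach_point_closed hconv hclosed hnot
  set α := f (1, 0, 0) with hα
  set β := f (0, 1, 0) with hβ
  set γ := f (0, 0, 1) with hγ
  have hf : ∀ a b c : ℝ, f (a, b, c) = α * a + β * b + γ * c := by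
    intro a b c
    have : ((a, b, c) : ℝ × ℝ × ℝ) = a • (1, 0, 0) + b • (0, 1, 0) + c • (0, 0, 1) := by simp
    rw [this, map_add, map_add, map_smul, map_smul, map_smul]
    simp only [smul_eq_mul, ← hα, ← hβ, ← hγ]
    ring
  obtain ⟨q₀, hq₀, hE₀⟩ := exists_isJoint_Ed_eq_zero hP hd0
  have hmono : ∀ w : ℝ × ℝ × ℝ, 0 ≤ w → 0 ≤ f w := by
    intro w hw
    by_contra! hneg
    have hs : ∀ s : ℝ, 0 ≤ s → u < f (F q₀) + s * f w := fun s hs => by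
      have := hCu (F q₀ + s • w) ⟨q₀, hq₀, le_add_of_nonneg_right (smul_nonneg hs hw)⟩
      simpa using this
    have h0 := hs 0 le_rfl
    have h1 := hs ((u - f (F q₀)) / f w) (div_nonneg_of_nonpos (by linarith) hneg.le)
    rw [div_mul_cancel₀ _ hneg.ne] at h1
    linarith
  have hα0 : 0 ≤ α := hmono _ ⟨zero_le_one, le_rfl, le_rfl⟩
  have hβ0 : 0 ≤ β := hmono _ ⟨le_rfl, zero_le_one, le_rfl⟩
  have hγ0 : 0 ≤ γ := hmono _ ⟨le_rfl, le_rfl, zero_le_one⟩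
  have hsep : ∀ q : X → Y → ℝ, IsJoint q → α * t + β * t <
      α * klX q P + β * (mutInfo q + klX q P - R) + γ * (Ed q d - Δ) := fun q hq => by
    have := hfu.trans (hCu (F q) ⟨q, hq, le_rfl⟩)
    simpa only [F, hf, mul_zero, add_zero] using this
  have hpos : 0 < α + β := by
    refine (add_nonneg hα0 hβ0).lt_of_ne fun h => ?_
    have ha : α = 0 := by linarith
    have hb : β = 0 := by linarith
    have h := hsep q₀ hq₀
    rw [hE₀, ha, hb] at h
    have := mul_nonneg hγ0 hΔ
    linarith
  refine ⟨β / (α + β), γ / (α + β), by positivity, div_le_one_of_le₀ (by linarith) hpos.le,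
    by positivity, ?_⟩
  suffices h : t + β / (α + β) * R + γ / (α + β) * Δ ≤ OmegaF P d (γ / (α + β)) (β / (α + β)) by
    linarith
  refine le_csInf ⟨_, q₀, hq₀, rfl⟩ ?_
  rintro _ ⟨q, hq, rfl⟩
  have h := hsep q hq
  refine le_of_mul_le_mul_left ?_ hpos
  have e₁ : (α + β) * (t + β / (α + β) * R + γ / (α + β) * Δ) =
      (α + β) * t + β * R + γ * Δ := by field_simp
  have e₂ : (α + β) * (β / (α + β) * mutInfo q + klX q P + γ / (α + β) * Ed q d) =
      β * mutInfo q + (α + β) * klX q P + γ * Ed q d := by field_simp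
  rw [e₁, e₂]
  linarith

end joint

/-- Corollary 1: the parametric expression for `G^{(μ,λ)}(R,Δ|P)`
and the resulting sup-expression for `G(R,Δ|P)`. -/
theorem stmt16 {X Y : Type*} [Fintype X] [Fintype Y]
    (P : X → ℝ) (hP : IsDist P) (hPpos : ∀ x, 0 < P x)
    (d : X → Y → ℝ) (hd : ∀ x y, 0 ≤ d x y) (hd0 : ∀ x, ∃ y, d x y = 0) :
    (∀ μ lam R Δ : ℝ, 0 ≤ μ → 0 ≤ lam → lam ≤ 1 →
      Gmulam P d μ lam R Δ = -(lam * R) - μ * Δ + innerMin P d μ lam) ∧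
    (∀ R Δ : ℝ, 0 ≤ R → 0 ≤ Δ →
      G P d R Δ = sSup {v : ℝ | ∃ lam μ : ℝ, 0 ≤ lam ∧ lam ≤ 1 ∧ 0 ≤ μ ∧
        v = -(lam * R) - μ * Δ + innerMin P d μ lam}) := by
  have hX : Nonempty X := by
    by_contra h
    rw [not_nonempty_iff] at h
    simpa using hP.2
  have hY : Nonempty Y := (hd0 hX.some).nonempty
  refine ⟨fun μ lam R Δ _ h0 h1 => ?_, fun R Δ _ hΔ => ?_⟩
  · rw [Gmulam, omegaF_eq_innerMin hPpos d h0 h1]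
    ring
  · have hle : ∀ v ∈ {v : ℝ | ∃ lam μ : ℝ, 0 ≤ lam ∧ lam ≤ 1 ∧ 0 ≤ μ ∧
        v = -(lam * R) - μ * Δ + innerMin P d μ lam}, v ≤ G P d R Δ := by
      rintro _ ⟨lam, μ, h0, h1, hμ, rfl⟩
      rw [← omegaF_eq_innerMin hPpos d h0 h1]
      exact omegaF_sub_le_G hP hPpos hd0 hΔ h0 h1 hμ
    apply le_antisymm
    · refine le_of_forall_lt fun t ht => ?_
      obtain ⟨s, hts, hs⟩ := exists_between ht
      obtain ⟨lam, μ, h0, h1, hμ, h⟩ := exists_le_omegaF_sub hP hPpos hd0 hΔ hs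
      rw [omegaF_eq_innerMin hPpos d h0 h1] at h
      exact (hts.trans_le h).trans_le (le_csSup ⟨_, hle⟩ ⟨lam, μ, h0, h1, hμ, rfl⟩)
    · exact csSup_le ⟨_, 0, 0, le_rfl, zero_le_one, le_rfl, rfl⟩ hle
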